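/- Let t = (1/2)(1+e^0)·∏_{μ=1}^{d-1}(1/2)(1 + i e^{2μ-1}e^{2μ}) in C⊗Cl(1,2d-1), L(t) = {U ∈ C⊗Cl(1,2d-1) : U t = U} the left ideal generated by t, and Q'^(0) the even part of the real subalgebra generated by e^0,e^1,e^2,e^3,e^5,...,e^{2d-1}. Then for every φ ∈ L(t) there exists a unique Ψ ∈ Q'^(0) with φ = Ψ t. -/

import Mathlib

open CliffordAlgebra TensorProduct

/-- The quadratic form of signature (1, m-1) on `Fin m → ℝ`. -/
noncomputable def Qf (m : ℕ) : QuadraticForm ℝ (Fin m → ℝ) :=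
  QuadraticMap.weightedSumSquares ℝ (fun i : Fin m => if (i : ℕ) = 0 then (1 : ℝ) else -1)

/-- The real Clifford algebra Cl(1, m-1). -/
abbrev Cl (m : ℕ) : Type := CliffordAlgebra (Qf m)

/-- The generator e^k of Cl(1,m-1), for k < m (junk value 0 otherwise). -/
noncomputable def eR (m : ℕ) (k : ℕ) : Cl m :=
  if h : k < m then CliffordAlgebra.ι (Qf m) (Pi.single (⟨k, h⟩ : Fin m) 1) else 0

/-- The complexified Clifford algebra ℂ ⊗ Cl(1,m-1). -/
abbrev CCl (m : ℕ) : Type := ℂ ⊗[ℝ] Cl m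

/-- The embedding of the real Clifford algebra into its complexification. -/
noncomputable def inc (m : ℕ) : Cl m →ₐ[ℝ] CCl m := Algebra.TensorProduct.includeRight

/-- The generator e^k inside the complexification. -/
noncomputable def eC (m : ℕ) (k : ℕ) : CCl m := inc m (eR m k)

/-- The list of commuting factors (1/2)(1 + i e^{2j+1} e^{2j+2}), j = 0, …, k-1,
i.e. (1/2)(1 + i e^{2μ-1} e^{2μ}) for μ = 1, …, k. -/
noncomputable def facs (m k : ℕ) : List (CCl m) :=
  (List.range k).map fun j =>
    (2 : ℂ)⁻¹ • ((1 : CCl m) + Complex.I • (eC m (2 * j + 1) * eC m (2 * j + 2)))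

/-- The idempotent t = (1/2)(1 + e^0) ∏_{μ=1}^{k} (1/2)(1 + i e^{2μ-1} e^{2μ}). -/
noncomputable def tIdem (m k : ℕ) : CCl m :=
  ((2 : ℂ)⁻¹ • ((1 : CCl m) + eC m 0)) * (facs m k).prod

/-- Reversion composed with complex conjugation on ℂ ⊗ Cl(1,m-1). -/
noncomputable def starC (m : ℕ) : CCl m →ₗ[ℝ] CCl m :=
  TensorProduct.map Complex.conjAe.toLinearMap (CliffordAlgebra.reverse (Q := Qf m))

/-- Hermitian conjugation U† = e^0 U* e^0. -/
noncomputable def dagger (m : ℕ) (U : CCl m) : CCl m := eC m 0 * starC m U * eC m 0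

/-- The scalar-part (grade-zero) projection of the real Clifford algebra. -/
noncomputable def scalR (m : ℕ) : Cl m →ₗ[ℝ] ℝ :=
  (ExteriorAlgebra.algebraMapInv (R := ℝ) (M := Fin m → ℝ)).toLinearMap ∘ₗ
    (CliffordAlgebra.equivExterior (Qf m)).toLinearMap

/-- The scalar-part projection ⟨·⟩₀ of the complexified Clifford algebra. -/
noncomputable def scalC (m : ℕ) : CCl m →ₗ[ℝ] ℂ :=
  (TensorProduct.rid ℝ ℂ).toLinearMap ∘ₗ TensorProduct.map LinearMap.id (scalR m)

/-- The inner product (U, V) = ⟨U† V⟩₀. -/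
noncomputable def ip (m : ℕ) (U V : CCl m) : ℂ := scalC m (dagger m U * V)

/-- `x = exp a` in the sense of the usual power series ∑ aᵏ/k!, tested against
all real linear functionals. -/
def IsExpOf (m : ℕ) (a x : Cl m) : Prop :=
  ∀ l : Cl m →ₗ[ℝ] ℝ, HasSum (fun k : ℕ => ((k.factorial : ℝ))⁻¹ • l (a ^ k)) (l x)

/-- The element I = -e¹e² of Cl(1, m-1). -/
noncomputable def Iel (m : ℕ) : Cl m := -(eR m 1 * eR m 2)

/-- The element I = -e¹e² of ℂ ⊗ Cl(1, m-1). -/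
noncomputable def IelC (m : ℕ) : CCl m := -(eC m 1 * eC m 2)

/-- The generators e⁰, e¹, e², e³, e⁵, e⁷, …  (e⁰, e², and odd-index generators). -/
def QpGens (m : ℕ) : Set (Cl m) :=
  {u | ∃ k : ℕ, k < m ∧ (k = 0 ∨ k = 2 ∨ Odd k) ∧ u = eR m k}

/-- The even part Q'⁽⁰⁾ of the real subalgebra Q' generated by e⁰, e¹, e², e³, e⁵, …, e^{2d-1}. -/
noncomputable def Qp0 (m : ℕ) : Subalgebra ℝ (Cl m) :=
  Algebra.adjoin ℝ (QpGens m) ⊓ CliffordAlgebra.even (Qf m)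


section aux

lemma eR_anti (m k l : ℕ) (h : k ≠ l) : eR m k * eR m l = -(eR m l * eR m k) := by
  unfold eR
  split_ifs with h1 h2 h2
  · rw [eq_neg_iff_add_eq_zero]
    rw [CliffordAlgebra.ι_mul_ι_add_swap]
    have : QuadraticMap.polar (Qf m) (Pi.single (⟨k, h1⟩ : Fin m) (1 : ℝ))
        (Pi.single (⟨l, h2⟩ : Fin m) 1) = 0 := by
      simp only [QuadraticMap.polar, Qf, QuadraticMap.weightedSumSquares_apply]
      rw [← Finset.sum_sub_distrib, ← Finset.sum_sub_distrib]
      apply Finset.sum_eq_zero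
      intro i _
      simp only [Pi.add_apply, Pi.single_apply, Fin.ext_iff]
      by_cases hk : (i : ℕ) = k
      · have : (i : ℕ) ≠ l := by omega
        simp [hk, h]
      · simp [hk]
    rw [this, map_zero]
  all_goals simp

lemma Qf_single (m k : ℕ) (h : k < m) :
    Qf m (Pi.single (⟨k, h⟩ : Fin m) (1 : ℝ)) = if k = 0 then 1 else -1 := by
  simp only [Qf, QuadraticMap.weightedSumSquares_apply]
  rw [Finset.sum_eq_single (⟨k, h⟩ : Fin m)]
  · simp
  · intro b _ hb
    simp [hb]
  · simp

lemma eR_sq (m k : ℕ) (h : k < m) (hk : k ≠ 0) : eR m k * eR m k = -1 := by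
  unfold eR
  rw [dif_pos h, CliffordAlgebra.ι_sq_scalar, Qf_single, if_neg hk]
  simp

lemma eR_sq0 (m : ℕ) (h : 0 < m) : eR m 0 * eR m 0 = 1 := by
  unfold eR
  rw [dif_pos h, CliffordAlgebra.ι_sq_scalar, Qf_single, if_pos rfl]
  simp

lemma eC_anti (m k l : ℕ) (h : k ≠ l) : eC m k * eC m l = -(eC m l * eC m k) := by
  unfold eC
  rw [← map_mul, eR_anti m k l h, map_neg, map_mul]

lemma eC_sq (m k : ℕ) (h : k < m) (hk : k ≠ 0) : eC m k * eC m k = -1 := by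
  unfold eC
  rw [← map_mul, eR_sq m k h hk, map_neg, map_one]

lemma eC_sq0 (m : ℕ) (h : 0 < m) : eC m 0 * eC m 0 = 1 := by
  unfold eC
  rw [← map_mul, eR_sq0 m h, map_one]

lemma cneg_mul {m : ℕ} (a b : CCl m) : -a * b = -(a * b) := neg_mul a b

lemma cmul_neg {m : ℕ} (a b : CCl m) : a * -b = -(a * b) := mul_neg a b

lemma eC_comm (m k a b : ℕ) (h : k ≠ a) (h' : k ≠ b) : Commute (eC m k) (eC m a * eC m b) := by
  show eC m k * (eC m a * eC m b) = (eC m a * eC m b) * eC m k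
  rw [← mul_assoc, eC_anti m k a h, cneg_mul, mul_assoc, eC_anti m k b h', cmul_neg, neg_neg, mul_assoc]

/-- the elements `i e^{2j+1} e^{2j+2}` -/
noncomputable def ww (m j : ℕ) : CCl m := Complex.I • (eC m (2 * j + 1) * eC m (2 * j + 2))

noncomputable def ff (m j : ℕ) : CCl m := (2 : ℂ)⁻¹ • ((1 : CCl m) + ww m j)

noncomputable def FF (m n : ℕ) : CCl m := (facs m n).prod

lemma FF_zero (m : ℕ) : FF m 0 = 1 := by simp [FF, facs]

lemma FF_succ (m n : ℕ) : FF m (n + 1) = FF m n * ff m n := by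
  simp [FF, facs, List.range_succ, ff, ww]

lemma ww_comm (m k j : ℕ) (h : k ≠ 2 * j + 1) (h' : k ≠ 2 * j + 2) : Commute (eC m k) (ww m j) :=
  (eC_comm m k _ _ h h').smul_right _

lemma ff_comm {m j : ℕ} {x : CCl m} (h : Commute x (ww m j)) : Commute x (ff m j) :=
  ((Commute.one_right x).add_right h).smul_right _

lemma FF_comm (m k : ℕ) (n : ℕ) (h : 2 * n < k) : Commute (eC m k) (FF m n) := by
  induction n with
  | zero => rw [FF_zero]; exact Commute.one_right _
  | succ n ih =>
    rw [FF_succ]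
    exact (ih (by omega)).mul_right (ff_comm (ww_comm m k n (by omega) (by omega)))

lemma ww_sq (m j : ℕ) (h : 2 * j + 2 < m) : ww m j * ww m j = 1 := by
  unfold ww
  rw [smul_mul_smul_comm, Complex.I_mul_I]
  have h1 := eC_anti m (2 * j + 2) (2 * j + 1) (by omega)
  have : eC m (2 * j + 1) * eC m (2 * j + 2) * (eC m (2 * j + 1) * eC m (2 * j + 2)) = -1 := by
    rw [mul_assoc, ← mul_assoc (eC m (2 * j + 2)), h1, cneg_mul, cmul_neg, mul_assoc,
      eC_sq m (2 * j + 2) h (by omega), cmul_neg, cmul_neg, mul_one, neg_neg,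
      eC_sq m (2 * j + 1) (by omega) (by omega)]
  rw [this]
  simp

lemma ww_ff (m j : ℕ) (h : 2 * j + 2 < m) : ww m j * ff m j = ff m j := by
  unfold ff
  rw [mul_smul_comm, mul_add, ww_sq m j h, mul_one, add_comm]

lemma ww_FF (m j n : ℕ) (h : 2 * n < m) (hj : j < n) : ww m j * FF m n = FF m n := by
  induction n with
  | zero => omega
  | succ n ih =>
    rw [FF_succ]
    rcases Nat.lt_or_ge j n with h1 | h1
    · rw [← mul_assoc, ih (by omega) h1]
    · obtain rfl : j = n := by omega
      have : Commute (ww m j) (FF m j) := 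
        ((FF_comm m _ j (by omega)).mul_left (FF_comm m _ j (by omega))).smul_left _
      rw [← mul_assoc, this.eq, mul_assoc, ww_ff m j (by omega)]

lemma e_ff (m j : ℕ) :
    eC m (2 * j + 2) * ff m j = (1 - ff m j) * eC m (2 * j + 2) := by
  have h1 := eC_anti m (2 * j + 2) (2 * j + 1) (by omega)
  have h2 : eC m (2 * j + 2) * ww m j = - (ww m j * eC m (2 * j + 2)) := by
    unfold ww
    rw [mul_smul_comm, smul_mul_assoc, ← mul_assoc, h1, cneg_mul, smul_neg]
  have h3 : (1 : CCl m) - ff m j = (2 : ℂ)⁻¹ • (1 - ww m j) := by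
    unfold ff
    have : (1 : CCl m) = (2 : ℂ)⁻¹ • (1 + 1) := by
      rw [← two_smul ℂ, smul_smul]; norm_num
    nth_rewrite 1 [this]
    rw [← smul_sub]; congr 1; abel
  rw [h3]
  unfold ff
  rw [mul_smul_comm, smul_mul_assoc, mul_add, h2, sub_mul, mul_one, one_mul, sub_eq_add_neg]

lemma inv_eR (m k : ℕ) : involute (eR m k) = - eR m k := by
  unfold eR
  split_ifs <;> simp

lemma e_adj (m k : ℕ) (hk : 2 < k) (hk' : Even k) (Ψ : Cl m)
    (h : Ψ ∈ Algebra.adjoin ℝ (QpGens m)) : eR m k * Ψ = involute Ψ * eR m k := by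
  induction h using Algebra.adjoin_induction with
  | mem x hx =>
    obtain ⟨l, _, h2, rfl⟩ := hx
    have : k ≠ l := by
      rintro rfl
      rcases h2 with h2 | h2 | h2
      · omega
      · omega
      · exact (Nat.not_odd_iff_even.2 hk') h2
    rw [inv_eR, eR_anti m k l this, neg_mul]
  | algebraMap r => rw [AlgHom.commutes, Algebra.commutes]
  | add x y _ _ hx hy => rw [mul_add, map_add, add_mul, hx, hy]
  | mul x y _ _ hx hy => rw [map_mul, ← mul_assoc, hx, mul_assoc, hy, mul_assoc]

lemma e_Qp0 (m k : ℕ) (hk : 2 < k) (hk' : Even k) (Ψ : Cl m)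
    (h : Ψ ∈ Qp0 m) : Commute (eC m k) (inc m Ψ) := by
  have h1 := e_adj m k hk hk' Ψ h.1
  rw [involute_eq_of_mem_even (show Ψ ∈ evenOdd (Qf m) 0 from h.2)] at h1
  show inc m _ * _ = _ * inc m _
  rw [← map_mul, ← map_mul, h1]

/-- grade involution on the complexification -/
noncomputable def invC (m : ℕ) : CCl m →ₐ[ℂ] CCl m :=
  Algebra.TensorProduct.map (AlgHom.id ℂ ℂ) (involute (Q := Qf m))

lemma invC_inc (m : ℕ) (x : Cl m) : invC m (inc m x) = inc m (involute x) := by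
  simp [invC, inc]

lemma invC_eC (m k : ℕ) : invC m (eC m k) = - eC m k := by
  unfold eC
  rw [invC_inc, inv_eR, map_neg]

lemma invC_ff (m j : ℕ) : invC m (ff m j) = ff m j := by
  simp [ff, ww, invC_eC, cneg_mul, cmul_neg]

lemma invC_FF (m n : ℕ) : invC m (FF m n) = FF m n := by
  induction n with
  | zero => simp [FF_zero]
  | succ n ih => rw [FF_succ, map_mul, ih, invC_ff]

lemma inj_step1 (m n : ℕ) (Ψ : Cl m) (h : Ψ ∈ Qp0 m)
    (h0 : inc m Ψ * tIdem m n = 0) : inc m Ψ * FF m n = 0 := by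
  have h1 := congrArg (invC m) h0
  have h2 : involute Ψ = Ψ := involute_eq_of_mem_even (show Ψ ∈ evenOdd (Qf m) 0 from h.2)
  change inc m Ψ * (((2 : ℂ)⁻¹ • ((1 : CCl m) + eC m 0)) * FF m n) = 0 at h0
  change invC m (inc m Ψ * (((2 : ℂ)⁻¹ • ((1 : CCl m) + eC m 0)) * FF m n)) = _ at h1
  rw [map_mul, map_mul, map_smul, map_add, map_one, invC_eC, invC_FF, invC_inc, h2, map_zero] at h1
  have h3 : inc m Ψ * (((2 : ℂ)⁻¹ • ((1 : CCl m) + eC m 0)) * FF m n) +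
    inc m Ψ * (((2 : ℂ)⁻¹ • ((1 : CCl m) + -eC m 0)) * FF m n) = 0 := by rw [h0, h1, add_zero]
  rw [← mul_add, ← add_mul, ← smul_add] at h3
  have : (2 : ℂ)⁻¹ • ((1 : CCl m) + eC m 0 + (1 + -eC m 0)) = 1 := by
    have : (1 : CCl m) + eC m 0 + (1 + -eC m 0) = (2 : ℂ) • 1 := by rw [two_smul]; abel
    rw [this, smul_smul]; norm_num
  rwa [this, one_mul] at h3

lemma inj_step2 (m n : ℕ) (hn : 2 * n + 2 < m) (hn0 : 1 ≤ n) (Ψ : Cl m) (h : Ψ ∈ Qp0 m)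
    (h0 : inc m Ψ * FF m (n + 1) = 0) : inc m Ψ * FF m n = 0 := by
  rw [FF_succ, ← mul_assoc] at h0
  have hc : Commute (eC m (2 * n + 2)) (inc m Ψ * FF m n) :=
    (e_Qp0 m _ (by omega) ⟨n + 1, by ring⟩ Ψ h).mul_right (FF_comm m _ n (by omega))
  have h1 : eC m (2 * n + 2) * (inc m Ψ * FF m n * ff m n) = 0 := by rw [h0, mul_zero]
  rw [← mul_assoc, hc.eq, mul_assoc, e_ff, ← mul_assoc] at h1
  have h2 : inc m Ψ * FF m n * (1 - ff m n) * eC m (2 * n + 2) * eC m (2 * n + 2) = 0 := by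
    rw [h1, zero_mul]
  rw [mul_assoc, eC_sq m _ hn (by omega), cmul_neg, mul_one, neg_eq_zero, mul_sub, h0, mul_one,
    sub_zero] at h2
  exact h2

lemma inj_step3 (m n : ℕ) (hn : 2 * n < m) (hn0 : 1 ≤ n) (Ψ : Cl m) (h : Ψ ∈ Qp0 m)
    (h0 : inc m Ψ * FF m n = 0) : inc m Ψ * ff m 0 = 0 := by
  induction n, hn0 using Nat.le_induction with
  | base => rwa [FF_succ, FF_zero, one_mul] at h0
  | succ n hn1 ih => exact ih (by omega) (inj_step2 m n (by omega) hn1 Ψ h h0)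

/-- real part -/
noncomputable def reC (m : ℕ) : CCl m →ₗ[ℝ] Cl m :=
  (TensorProduct.lid ℝ (Cl m)).toLinearMap ∘ₗ TensorProduct.map Complex.reLm LinearMap.id

lemma inj_step4 (m : ℕ) (Ψ : Cl m) (h0 : inc m Ψ * ff m 0 = 0) : Ψ = 0 := by
  have h1 : inc m Ψ * ((1 : CCl m) + ww m 0) = 0 := by
    unfold ff at h0
    rw [mul_smul_comm] at h0
    exact (smul_eq_zero.1 h0).resolve_left (by norm_num)
  have h2 : inc m Ψ * ((1 : CCl m) + ww m 0)
      = (1 : ℂ) ⊗ₜ Ψ + Complex.I ⊗ₜ[ℝ] (Ψ * (eR m 1 * eR m 2)) := by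
    simp [ww, inc, eC, mul_add, TensorProduct.smul_tmul']
  rw [h2] at h1
  simpa [reC] using congrArg (reC m) h1

lemma t_e0 (m n : ℕ) (hm : 0 < m) : eC m 0 * tIdem m n = tIdem m n := by
  unfold tIdem
  rw [← mul_assoc, mul_smul_comm, mul_add, eC_sq0 m hm, mul_one, add_comm]

lemma t_ww (m j n : ℕ) (h : 2 * n < m) (hj : j < n) : ww m j * tIdem m n = tIdem m n := by
  have hc : Commute (ww m j) ((2 : ℂ)⁻¹ • ((1 : CCl m) + eC m 0)) :=
    ((Commute.one_right _).add_right (ww_comm m 0 j (by omega) (by omega)).symm).smul_right _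
  change ww m j * (_ * FF m n) = _ * FF m n
  rw [← mul_assoc, hc.eq, mul_assoc, ww_FF m j n h hj]

lemma t_I (m n : ℕ) (h : 2 * n < m) (hn : 0 < n) :
    eC m 1 * eC m 2 * tIdem m n = - (Complex.I • tIdem m n) := by
  have h1 := t_ww m 0 n h hn
  unfold ww at h1
  simp only [mul_zero, zero_add] at h1
  nth_rewrite 2 [← h1]
  rw [smul_mul_assoc, smul_smul, Complex.I_mul_I, neg_smul, one_smul, neg_neg]

lemma t_even (m j n : ℕ) (h : 2 * n < m) (hj : j < n) :
    eC m (2 * j + 2) * tIdem m n = Complex.I • (eC m (2 * j + 1) * tIdem m n) := by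
  nth_rewrite 2 [← t_ww m j n h hj]
  unfold ww
  rw [smul_mul_assoc, mul_smul_comm, smul_smul, Complex.I_mul_I, ← mul_assoc, ← mul_assoc,
    eC_sq m _ (by omega) (by omega), cneg_mul, cneg_mul, one_mul]
  simp

lemma eR_even_one (m k : ℕ) : eR m k ∈ evenOdd (Qf m) 1 := by
  unfold eR
  split_ifs
  · exact ι_mem_evenOdd_one _ _
  · exact zero_mem _

lemma Qp0_mem2 (m k l : ℕ) (hk : eR m k ∈ Algebra.adjoin ℝ (QpGens m))
    (hl : eR m l ∈ Algebra.adjoin ℝ (QpGens m)) (Ψ : Cl m) (h : Ψ ∈ Qp0 m) :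
    eR m k * Ψ * eR m l ∈ Qp0 m := by
  refine ⟨mul_mem (mul_mem hk h.1) hl, ?_⟩
  have h2 : Ψ ∈ evenOdd (Qf m) 0 := h.2
  have := SetLike.mul_mem_graded (SetLike.mul_mem_graded (eR_even_one m k) h2) (eR_even_one m l)
  exact this

lemma gen_mem (m k : ℕ) (h : k = 0 ∨ k = 2 ∨ Odd k) : eR m k ∈ Algebra.adjoin ℝ (QpGens m) := by
  by_cases hk : k < m
  · exact Algebra.subset_adjoin ⟨k, hk, h, rfl⟩
  · unfold eR; rw [dif_neg hk]; exact zero_mem _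

noncomputable def SS (m n : ℕ) : Submodule ℝ (CCl m) :=
  (Qp0 m).toSubmodule.map ((LinearMap.mulRight ℝ (tIdem m n)) ∘ₗ (inc m).toLinearMap)

lemma mem_SS {m n : ℕ} {x : CCl m} :
    x ∈ SS m n ↔ ∃ Ψ ∈ Qp0 m, inc m Ψ * tIdem m n = x := by
  simp [SS]

lemma SS_I (m n : ℕ) (h : 2 * n < m) (hn : 0 < n) (x : CCl m) (hx : x ∈ SS m n) :
    Complex.I • x ∈ SS m n := by
  rw [mem_SS] at *
  obtain ⟨Ψ, hΨ, rfl⟩ := hx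
  have h12 : eR m 1 * eR m 2 ∈ Qp0 m := by
    have := Qp0_mem2 m 1 2 (gen_mem m 1 (by decide)) (gen_mem m 2 (by decide)) 1 (one_mem _)
    rwa [mul_one] at this
  refine ⟨-(Ψ * (eR m 1 * eR m 2)), neg_mem (mul_mem hΨ h12), ?_⟩
  rw [map_neg, map_mul, map_mul, cneg_mul, mul_assoc]
  change -(inc m Ψ * (eC m 1 * eC m 2 * tIdem m n)) = _
  rw [t_I m n h hn, cmul_neg, neg_neg, mul_smul_comm]

lemma SS_gen (m n k : ℕ) (hm : 0 < m) (hk : k = 0 ∨ k = 2 ∨ Odd k) (x : CCl m)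
    (hx : x ∈ SS m n) : eC m k * x ∈ SS m n := by
  rw [mem_SS] at *
  obtain ⟨Ψ, hΨ, rfl⟩ := hx
  refine ⟨eR m k * Ψ * eR m 0,
    Qp0_mem2 m k 0 (gen_mem m k hk) (gen_mem m 0 (by decide)) Ψ hΨ, ?_⟩
  rw [map_mul, map_mul, mul_assoc]
  change _ * (eC m 0 * _) = inc m (eR m k) * _
  rw [t_e0 m n hm, mul_assoc]

lemma SS_even (m n j : ℕ) (h : 2 * n < m) (hj : j < n) (hj0 : 0 < j) (x : CCl m)
    (hx : x ∈ SS m n) : eC m (2 * j + 2) * x ∈ SS m n := by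
  have hx' := hx
  rw [mem_SS] at hx'
  obtain ⟨Ψ, hΨ, rfl⟩ := hx'
  rw [← mul_assoc, (e_Qp0 m _ (by omega) ⟨j + 1, by ring⟩ Ψ hΨ).eq, mul_assoc,
    t_even m j n h hj, mul_smul_comm]
  apply SS_I m n h (by omega)
  have h1 : eC m (2 * j + 1) * tIdem m n ∈ SS m n := by
    apply SS_gen m n _ (by omega) (Or.inr (Or.inr ⟨j, rfl⟩))
    exact mem_SS.2 ⟨1, one_mem _, by simp⟩
  obtain ⟨Ψ', h2, h3⟩ := mem_SS.1 h1
  rw [← h3, ← mul_assoc, ← map_mul]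
  exact mem_SS.2 ⟨_, mul_mem hΨ h2, rfl⟩

lemma SS_eC (d : ℕ) (hd : 2 ≤ d) (k : ℕ) (hk : k < 2 * d) (x : CCl (2 * d))
    (hx : x ∈ SS (2 * d) (d - 1)) : eC (2 * d) k * x ∈ SS (2 * d) (d - 1) := by
  by_cases h : k = 0 ∨ k = 2 ∨ Odd k
  · exact SS_gen _ _ k (by omega) h x hx
  · push Not at h
    obtain ⟨h1, h2, h3⟩ := h
    rw [Nat.not_odd_iff_even] at h3
    obtain ⟨r, hr⟩ := h3
    obtain ⟨j, rfl⟩ : ∃ j, k = 2 * j + 2 := ⟨r - 1, by omega⟩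
    exact SS_even _ _ j (by omega) (by omega) (by omega) x hx

lemma SS_inc (d : ℕ) (hd : 2 ≤ d) (y : Cl (2 * d)) : ∀ x ∈ SS (2 * d) (d - 1),
    inc (2 * d) y * x ∈ SS (2 * d) (d - 1) := by
  induction y using CliffordAlgebra.induction with
  | algebraMap r =>
    intro x hx
    rw [AlgHom.commutes, ← Algebra.smul_def]
    exact Submodule.smul_mem _ _ hx
  | ι v =>
    intro x hx
    have : ι (Qf (2 * d)) v = ∑ i, v i • eR (2 * d) i := by
      conv_lhs => rw [pi_eq_sum_univ' v]
      rw [map_sum]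
      refine Finset.sum_congr rfl fun i _ => ?_
      rw [map_smul]
      unfold eR
      rw [dif_pos i.2]
    rw [this, map_sum, Finset.sum_mul]
    refine Submodule.sum_mem _ fun i _ => ?_
    rw [map_smul, smul_mul_assoc]
    exact Submodule.smul_mem _ _ (SS_eC d hd i i.2 x hx)
  | mul a b ha hb =>
    intro x hx
    rw [map_mul, mul_assoc]
    exact ha _ (hb _ hx)
  | add a b ha hb =>
    intro x hx
    rw [map_add, add_mul]
    exact add_mem (ha _ hx) (hb _ hx)

lemma SS_all (d : ℕ) (hd : 2 ≤ d) (y : CCl (2 * d)) (x) (hx : x ∈ SS (2 * d) (d - 1)) :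
    y * x ∈ SS (2 * d) (d - 1) := by
  induction y using TensorProduct.induction_on with
  | zero => rw [zero_mul]; exact zero_mem _
  | add a b ha hb => rw [add_mul]; exact add_mem ha hb
  | tmul z a =>
    have h1 := SS_inc d hd a x hx
    have h2 : (z ⊗ₜ[ℝ] a : CCl (2 * d)) = z.re • inc (2 * d) a
        + z.im • (Complex.I • inc (2 * d) a) := by
      simp only [inc, Algebra.TensorProduct.includeRight_apply, TensorProduct.smul_tmul',
        ← TensorProduct.add_tmul]
      congr 1
      apply Complex.ext <;> simp
    rw [h2, add_mul, smul_mul_assoc, smul_mul_assoc, smul_mul_assoc]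
    exact add_mem (Submodule.smul_mem _ _ h1)
      (Submodule.smul_mem _ _ (SS_I _ _ (by omega) (by omega) _ h1))

end aux

/-- Every element φ of the left ideal L(t) has a unique decomposition φ = Ψ t with
Ψ in the even part Q'⁽⁰⁾ of the real subalgebra generated by e⁰,e¹,e²,e³,e⁵,…,e^{2d-1}. -/
theorem stmt12 (d : ℕ) (hd : 2 ≤ d) (φ : CCl (2 * d))
    (hφ : φ * tIdem (2 * d) (d - 1) = φ) :
    ∃! Ψ : Cl (2 * d), Ψ ∈ Qp0 (2 * d) ∧ inc (2 * d) Ψ * tIdem (2 * d) (d - 1) = φ := by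
  have h1 : φ ∈ SS (2 * d) (d - 1) := by
    rw [← hφ]
    exact SS_all d hd φ _ (mem_SS.2 ⟨1, one_mem _, by simp⟩)
  obtain ⟨Ψ, hΨ, h2⟩ := mem_SS.1 h1
  refine ⟨Ψ, ⟨hΨ, h2⟩, ?_⟩
  rintro Ψ' ⟨hΨ', h3⟩
  have h4 : Ψ' - Ψ ∈ Qp0 (2 * d) := sub_mem hΨ' hΨ
  rw [← sub_eq_zero]
  apply inj_step4
  apply inj_step3 _ (d - 1) (by omega) (by omega) _ h4
  apply inj_step1 _ _ _ h4
  rw [map_sub, sub_mul, h2, h3, sub_self]
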